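/- Let n ≥ 1 and let F be a Banach space which contains no copy of c₀. Then for every continuous n-linear map T : c₀ × ⋯ × c₀ → F, the continuous n-homogeneous polynomial p : c₀ → F defined by p(x) = T(x,…,x) is approximable: for every ε > 0 there exists a finite type continuous n-linear map S : c₀ × ⋯ × c₀ → F such that sup_{‖x‖ ≤ 1} ‖T(x,…,x) − S(x,…,x)‖ ≤ ε. -/

import Mathlib

open Filter Topology

noncomputable section

namespace GV

/-- A continuous multilinear map is of *finite type* if it is a finite sum of maps of the form
`(x₁, …, xₙ) ↦ φ₁(x₁)⋯φₙ(xₙ) • f` with the `φᵢ` continuous linear functionals and `f ∈ F`. -/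
def IsFiniteType {𝕜 : Type*} [RCLike 𝕜] {n : ℕ} {E : Fin n → Type*}
    [∀ i, NormedAddCommGroup (E i)] [∀ i, NormedSpace 𝕜 (E i)]
    {F : Type*} [NormedAddCommGroup F] [NormedSpace 𝕜 F]
    (T : ContinuousMultilinearMap 𝕜 E F) : Prop :=
  ∃ (r : ℕ) (φ : Fin r → ∀ i, E i →L[𝕜] 𝕜) (f : Fin r → F),
    ∀ x : ∀ i, E i, T x = ∑ p : Fin r, (∏ i, φ p i (x i)) • f p

/-- A Banach space `F` contains a copy of `c₀` if there is a continuous linear map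
`ι : c₀ → F` which is an isomorphism onto its range, i.e. there are constants `0 < c ≤ C`
with `c‖x‖ ≤ ‖ι x‖ ≤ C‖x‖` for all `x ∈ c₀`. -/
def ContainsCopyOfC0 (𝕜 F : Type*) [RCLike 𝕜] [NormedAddCommGroup F] [NormedSpace 𝕜 F] : Prop :=
  ∃ (ι : ZeroAtInftyContinuousMap ℕ 𝕜 →L[𝕜] F) (c C : ℝ), 0 < c ∧ c ≤ C ∧
    ∀ x : ZeroAtInftyContinuousMap ℕ 𝕜, c * ‖x‖ ≤ ‖ι x‖ ∧ ‖ι x‖ ≤ C * ‖x‖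

section Helpers

variable {𝕜 : Type*} [RCLike 𝕜]
  {F : Type*} [NormedAddCommGroup F] [NormedSpace 𝕜 F]
  {G : Type*} [NormedAddCommGroup G] [NormedSpace 𝕜 G]

/-- **Rosenthal's lemma**: an infinite nonnegative matrix whose off-diagonal row sums are uniformly
bounded has an infinite principal submatrix with arbitrarily small off-diagonal row sums. -/
lemma exists_injective_offDiag_sum_le {ε : ℝ} (hε : 0 ≤ ε) (m : ℕ) (a : ℕ → ℕ → ℝ)
    (ha : ∀ i j, 0 ≤ a i j)
    (hsum : ∀ (i : ℕ) (s : Finset ℕ), i ∉ s → ∑ j ∈ s, a i j ≤ m * ε) :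
    ∃ g : ℕ → ℕ, Function.Injective g ∧
      ∀ (i : ℕ) (s : Finset ℕ), i ∉ s → ∑ j ∈ s, a (g i) (g j) ≤ ε := by
  induction m generalizing a with
  | zero =>
    exact ⟨id, Function.injective_id, fun i s hi => (hsum i s hi).trans (by simpa using hε)⟩
  | succ m ih =>
    by_cases hp : ∃ p, ∀ (i : ℕ) (s : Finset ℕ), i ∉ s →
        ∑ j ∈ s, a (Nat.pair p i) (Nat.pair p j) ≤ ε
    · obtain ⟨p, hp⟩ := hp
      exact ⟨Nat.pair p, fun i j h => (Nat.pair_eq_pair.1 h).2, hp⟩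
    · push Not at hp
      choose q s hq hs using hp
      obtain ⟨g, hg, hgs⟩ := ih (fun i j => a (Nat.pair i (q i)) (Nat.pair j (q j)))
        (fun _ _ => ha _ _) fun i t hi => by
          have hdisj : Disjoint (t.map ⟨fun j => Nat.pair j (q j),
              fun j k h => (Nat.pair_eq_pair.1 h).1⟩)
              ((s i).map ⟨Nat.pair i, fun j k h => (Nat.pair_eq_pair.1 h).2⟩) := by
            rw [Finset.disjoint_left]
            simp only [Finset.mem_map, not_exists, not_and]
            rintro _ ⟨j, hj, rfl⟩ k - h
            exact hi ((Nat.pair_eq_pair.1 h).1 ▸ hj)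
          have hmem : Nat.pair i (q i) ∉ t.map ⟨fun j => Nat.pair j (q j),
              fun j k h => (Nat.pair_eq_pair.1 h).1⟩ ∪
              (s i).map ⟨Nat.pair i, fun j k h => (Nat.pair_eq_pair.1 h).2⟩ := by
            simp only [Finset.mem_union, Finset.mem_map, not_or, not_exists, not_and]
            exact ⟨fun j hj h => hi ((Nat.pair_eq_pair.1 h).1 ▸ hj),
              fun k hk h => hq i ((Nat.pair_eq_pair.1 h).2 ▸ hk)⟩
          have h := hsum _ _ hmem
          rw [Finset.sum_union hdisj, Finset.sum_map, Finset.sum_map] at h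
          change ∑ j ∈ t, a (Nat.pair i (q i)) (Nat.pair j (q j)) +
            ∑ j ∈ s i, a (Nat.pair i (q i)) (Nat.pair i j) ≤ _ at h
          have := hs i
          push_cast at h
          linarith
      exact ⟨fun i => Nat.pair (g i) (q (g i)), fun i j h => hg (Nat.pair_eq_pair.1 h).1, hgs⟩

variable (𝕜) in
/-- The series `∑ fᵢ` is *weakly unconditionally Cauchy*: the finite sums `∑ ξᵢ fᵢ` are bounded,
uniformly over bounded scalar families `ξ`. -/
def IsWUC (f : ℕ → F) : Prop :=
  ∃ C : ℝ, 0 ≤ C ∧ ∀ (s : Finset ℕ) (ξ : ℕ → 𝕜) (η : ℝ), 0 ≤ η → (∀ i ∈ s, ‖ξ i‖ ≤ η) →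
    ‖∑ i ∈ s, ξ i • f i‖ ≤ C * η

variable (𝕜 F) in
/-- The terms of every weakly unconditionally Cauchy series in `F` tend to zero. -/
def WUCTermsNull : Prop :=
  ∀ f : ℕ → F, IsWUC 𝕜 f → Tendsto f cofinite (𝓝 0)

lemma IsWUC.sum_blocks {f : ℕ → F} (hf : IsWUC 𝕜 f) {t : ℕ → Finset ℕ}
    (ht : Pairwise fun m k => Disjoint (t m) (t k)) :
    IsWUC 𝕜 fun m => ∑ i ∈ t m, f i := by
  classical
  obtain ⟨C, hC, h⟩ := hf
  obtain ⟨idx, hidx⟩ : ∃ idx : ℕ → ℕ, ∀ m, ∀ i ∈ t m, idx i = m := by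
    refine ⟨fun i => if h : ∃ m, i ∈ t m then h.choose else 0, fun m i hi => ?_⟩
    have hex : ∃ m, i ∈ t m := ⟨m, hi⟩
    simp only [hex, dite_true]
    by_contra hne
    exact Finset.disjoint_left.1 (ht hne) hex.choose_spec hi
  refine ⟨C, hC, fun s ξ η hη hξ => ?_⟩
  have hsum : ∑ m ∈ s, ξ m • ∑ i ∈ t m, f i = ∑ i ∈ s.biUnion t, ξ (idx i) • f i := by
    rw [Finset.sum_biUnion fun m _ k _ hmk => ht hmk]
    refine Finset.sum_congr rfl fun m _ => ?_
    rw [Finset.smul_sum]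
    exact Finset.sum_congr rfl fun i hi => by rw [hidx m i hi]
  rw [hsum]
  refine h _ _ η hη fun i hi => ?_
  obtain ⟨m, hm, hi⟩ := Finset.mem_biUnion.1 hi
  rw [hidx m i hi]
  exact hξ m hm

lemma IsWUC.comp_injective {f : ℕ → F} (hf : IsWUC 𝕜 f) {g : ℕ → ℕ}
    (hg : Function.Injective g) : IsWUC 𝕜 (f ∘ g) := by
  simpa [Function.comp_def] using hf.sum_blocks (t := fun m => {g m})
    fun m k hmk => Finset.disjoint_singleton.2 (hg.ne hmk)

lemma IsWUC.clm_comp {f : ℕ → F} (hf : IsWUC 𝕜 f) (u : F →L[𝕜] G) :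
    IsWUC 𝕜 fun i => u (f i) := by
  obtain ⟨C, hC, h⟩ := hf
  refine ⟨‖u‖ * C, by positivity, fun s ξ η hη hξ => ?_⟩
  have : ∑ i ∈ s, ξ i • u (f i) = u (∑ i ∈ s, ξ i • f i) := by simp
  rw [this, mul_assoc]
  exact (u.le_opNorm _).trans (by gcongr; exact h s ξ η hη hξ)

lemma WUCTermsNull.summable [CompleteSpace F] (hF : WUCTermsNull 𝕜 F) {f : ℕ → F}
    (hf : IsWUC 𝕜 f) : Summable f := by
  classical
  rw [summable_iff_vanishing_norm]
  by_contra! h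
  obtain ⟨ε, hε, h⟩ := h
  obtain ⟨t, ht, hdisj⟩ := exists_seq_of_forall_finset_exists'
    (fun t : Finset ℕ => ε ≤ ‖∑ i ∈ t, f i‖) (fun s t => Disjoint s t) fun S _ => by
      obtain ⟨t, ht, hle⟩ := h (S.biUnion id)
      exact ⟨t, hle, fun x hx => (ht.mono_right (Finset.subset_biUnion_of_mem id hx)).symm⟩
  have hlim := (hF _ (hf.sum_blocks (t := t) hdisj)).norm
  rw [norm_zero] at hlim
  obtain ⟨m, hm⟩ := (hlim.eventually_lt_const hε).exists
  exact (ht m).not_gt hm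

lemma WUCTermsNull.congr (e : F ≃ₗᵢ[𝕜] G) (hF : WUCTermsNull 𝕜 F) : WUCTermsNull 𝕜 G := by
  intro f hf
  have h := hF _ (hf.clm_comp (e.symm.toContinuousLinearEquiv : G →L[𝕜] F))
  rw [tendsto_zero_iff_norm_tendsto_zero] at h ⊢
  simpa using h

section C0

variable (𝕜) in
/-- The space `c₀`. -/
abbrev C0 : Type _ := ZeroAtInftyContinuousMap ℕ 𝕜

lemma C0.norm_le {x : C0 𝕜} {r : ℝ} (hr : 0 ≤ r) : ‖x‖ ≤ r ↔ ∀ i, ‖x i‖ ≤ r := by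
  rw [← ZeroAtInftyContinuousMap.norm_toBCF_eq_norm, BoundedContinuousFunction.norm_le hr]
  rfl

lemma C0.norm_apply_le (x : C0 𝕜) (i : ℕ) : ‖x i‖ ≤ ‖x‖ :=
  (C0.norm_le (norm_nonneg x)).1 le_rfl i

lemma C0.tendsto_cofinite (x : C0 𝕜) : Tendsto x cofinite (𝓝 0) := by
  have h := x.zero_at_infty'
  rwa [cocompact_eq_cofinite] at h

variable (𝕜) in
/-- The `i`-th unit vector of `c₀`. -/
def C0.single (i : ℕ) : C0 𝕜 where
  toFun := fun j => if j = i then 1 else 0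
  continuous_toFun := continuous_of_discreteTopology
  zero_at_infty' := by
    rw [cocompact_eq_cofinite]
    refine tendsto_const_nhds.congr' ?_
    filter_upwards [(Set.finite_singleton i).compl_mem_cofinite] with j hj
    exact (if_neg hj).symm

lemma C0.single_apply (i j : ℕ) : C0.single 𝕜 i j = if j = i then 1 else 0 :=
  rfl

lemma C0.sum_apply {ι : Type*} (s : Finset ι) (f : ι → C0 𝕜) (j : ℕ) :
    (∑ i ∈ s, f i) j = ∑ i ∈ s, f i j := by
  classical
  induction s using Finset.induction_on with
  | empty => simp
  | insert a s ha ih => simp [Finset.sum_insert ha, ih]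

lemma C0.sum_smul_single_apply (s : Finset ℕ) (ξ : ℕ → 𝕜) (j : ℕ) :
    (∑ i ∈ s, ξ i • C0.single 𝕜 i) j = if j ∈ s then ξ j else 0 := by
  simp [C0.sum_apply, C0.single_apply]

variable (𝕜) in
/-- The `i`-th coordinate functional on `c₀`. -/
def C0.coord (i : ℕ) : C0 𝕜 →L[𝕜] 𝕜 :=
  LinearMap.mkContinuous
    { toFun := fun x => x i
      map_add' := fun _ _ => rfl
      map_smul' := fun _ _ => rfl } 1 fun x => by simpa using C0.norm_apply_le x i

@[simp]
lemma C0.coord_apply (i : ℕ) (x : C0 𝕜) : C0.coord 𝕜 i x = x i := rfl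

lemma C0.isWUC_single : IsWUC 𝕜 (C0.single 𝕜) := by
  refine ⟨1, zero_le_one, fun s ξ η hη hξ => ?_⟩
  rw [one_mul, C0.norm_le hη]
  intro j
  rw [C0.sum_smul_single_apply]
  split_ifs with h
  · exact hξ j h
  · simpa using hη

lemma IsWUC.summable_smul [CompleteSpace F] {f : ℕ → F} (hf : IsWUC 𝕜 f) (x : C0 𝕜) :
    Summable fun i => x i • f i := by
  obtain ⟨C, hC, h⟩ := hf
  rw [summable_iff_vanishing_norm]
  intro ε hε
  have hη : 0 < ε / (C + 1) := by positivity
  have hfin : {i | ¬ ‖x i‖ < ε / (C + 1)}.Finite := by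
    have := (C0.tendsto_cofinite x).norm
    rw [norm_zero] at this
    exact this.eventually_lt_const hη
  refine ⟨hfin.toFinset, fun t ht => ?_⟩
  refine (h t x _ hη.le fun i hi => ?_).trans_lt ?_
  · by_contra hlt
    exact Finset.disjoint_left.1 ht hi (hfin.mem_toFinset.2 fun h => hlt h.le)
  · rw [mul_div_assoc', div_lt_iff₀ (by positivity)]
    nlinarith

lemma C0.hasSum_single (x : C0 𝕜) : HasSum (fun i => x i • C0.single 𝕜 i) x := by
  obtain ⟨y, hy⟩ := C0.isWUC_single.summable_smul x
  suffices h : y = x by rwa [h] at hy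
  refine ZeroAtInftyContinuousMap.ext fun j => ?_
  have h₁ := hy.mapL (C0.coord 𝕜 j)
  have h₂ : HasSum (fun i => C0.coord 𝕜 j (x i • C0.single 𝕜 i)) (x j) := by
    convert _root_.hasSum_single j fun i hi => ?_ using 1
    · simp [C0.single_apply]
    · simp [C0.single_apply, hi.symm]
  exact h₁.unique h₂

end C0

/-- A weakly unconditionally Cauchy series with an almost biorthogonal bounded sequence of
functionals spans a copy of `c₀`. -/
lemma containsCopyOfC0_of_almost_biorthogonal [CompleteSpace F] {f : ℕ → F} (hf : IsWUC 𝕜 f)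
    {φ : ℕ → F →L[𝕜] 𝕜} (hφ : ∀ j, ‖φ j‖ ≤ 1) {δ : ℝ} (hδ : 0 < δ)
    (hdiag : ∀ j, δ ≤ ‖φ j (f j)‖)
    (hoff : ∀ (j : ℕ) (s : Finset ℕ), j ∉ s → ∑ k ∈ s, ‖φ j (f k)‖ ≤ δ / 2) :
    ContainsCopyOfC0 𝕜 F := by
  classical
  have hsum := hf.summable_smul
  obtain ⟨C, hC, h⟩ := hf
  have hle : ∀ x : C0 𝕜, ‖∑' k, x k • f k‖ ≤ C * ‖x‖ := fun x =>
    le_of_tendsto (hsum x).hasSum.norm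
      (Eventually.of_forall fun s => h s x _ (norm_nonneg x) fun i _ => C0.norm_apply_le x i)
  have hge : ∀ x : C0 𝕜, δ / 2 * ‖x‖ ≤ ‖∑' k, x k • f k‖ := fun x => by
    have key : ∀ j, δ * ‖x j‖ - δ / 2 * ‖x‖ ≤ ‖∑' k, x k • f k‖ := fun j => by
      refine ge_of_tendsto (hsum x).hasSum.norm ?_
      filter_upwards [eventually_ge_atTop {j}] with s hs
      have hj : j ∈ s := hs (Finset.mem_singleton_self j)
      have h₁ : ‖φ j (∑ k ∈ s, x k • f k)‖ ≤ ‖∑ k ∈ s, x k • f k‖ := by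
        simpa using (φ j).le_of_opNorm_le (hφ j) (∑ k ∈ s, x k • f k)
      have h₂ : ‖∑ k ∈ s.erase j, x k • φ j (f k)‖ ≤ δ / 2 * ‖x‖ := by
        calc ‖∑ k ∈ s.erase j, x k • φ j (f k)‖ ≤ ∑ k ∈ s.erase j, ‖φ j (f k)‖ * ‖x‖ :=
              norm_sum_le_of_le _ fun k _ => by
                rw [norm_smul, mul_comm]
                gcongr
                exact C0.norm_apply_le x k
          _ ≤ δ / 2 * ‖x‖ := by
              rw [← Finset.sum_mul]
              gcongr
              exact hoff j _ (Finset.notMem_erase j s)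
      have h₃ : φ j (∑ k ∈ s, x k • f k)
          = x j • φ j (f j) + ∑ k ∈ s.erase j, x k • φ j (f k) := by
        rw [Finset.add_sum_erase _ (fun k => x k • φ j (f k)) hj]
        simp
      have h₄ : δ * ‖x j‖ ≤ ‖x j • φ j (f j)‖ := by
        rw [norm_smul, mul_comm]
        gcongr
        exact hdiag j
      have h₅ := norm_sub_le (x j • φ j (f j) + ∑ k ∈ s.erase j, x k • φ j (f k))
        (∑ k ∈ s.erase j, x k • φ j (f k))
      rw [add_sub_cancel_right, ← h₃] at h₅
      linarith
    have hx : ‖x‖ ≤ (‖∑' k, x k • f k‖ + δ / 2 * ‖x‖) / δ :=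
      (C0.norm_le (by positivity)).2 fun j => by
        rw [le_div_iff₀ hδ]
        linarith [key j]
    rw [le_div_iff₀ hδ] at hx
    linarith
  refine ⟨LinearMap.mkContinuous
    { toFun := fun x : C0 𝕜 => ∑' k, x k • f k
      map_add' := fun x y => by
        rw [← (hsum x).tsum_add (hsum y)]
        simp [add_smul]
      map_smul' := fun c x => by
        rw [RingHom.id_apply, ← (hsum x).tsum_const_smul c]
        simp [mul_smul] } C hle, δ / 2, max C (δ / 2), by positivity, le_max_right _ _,
    fun x => ⟨hge x, (hle x).trans ?_⟩⟩
  gcongr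
  exact le_max_left _ _

lemma exists_injective_of_not_tendsto {f : ℕ → F} (hf : ¬ Tendsto f cofinite (𝓝 0)) :
    ∃ δ > 0, ∃ g : ℕ → ℕ, Function.Injective g ∧ ∀ k, δ ≤ ‖f (g k)‖ := by
  rw [tendsto_zero_iff_norm_tendsto_zero, Metric.tendsto_nhds] at hf
  push Not at hf
  obtain ⟨δ, hδ, hf⟩ := hf
  have hinf : {k | δ ≤ ‖f k‖}.Infinite := by
    rw [← Filter.frequently_cofinite_iff_infinite]
    simpa using hf
  exact ⟨δ, hδ, fun k => hinf.natEmbedding _ k,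
    Subtype.val_injective.comp (hinf.natEmbedding _).injective,
    fun k => (hinf.natEmbedding _ k).2⟩

/-- **Bessaga–Pełczyński**: in a Banach space without copies of `c₀`, weakly unconditionally Cauchy
series have null terms. -/
lemma wucTermsNull_of_not_containsCopyOfC0 [CompleteSpace F] (hF : ¬ ContainsCopyOfC0 𝕜 F) :
    WUCTermsNull 𝕜 F := by
  intro f hf
  by_contra hlim
  obtain ⟨δ, hδ, g, hg, hfg⟩ := exists_injective_of_not_tendsto hlim
  have hwuc := hf.comp_injective hg
  obtain ⟨C, hC, hbound⟩ := id hwuc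
  choose φ hφ hφf using fun k => exists_dual_vector'' 𝕜 (f (g k))
  obtain ⟨m, hm⟩ := exists_nat_ge (C / (δ / 2))
  rw [div_le_iff₀ (by positivity)] at hm
  obtain ⟨h, hh, hoff⟩ := exists_injective_offDiag_sum_le (half_pos hδ).le m
    (fun i j => ‖φ i (f (g j))‖) (fun _ _ => norm_nonneg _) fun i s _ => by
      refine le_trans ?_ hm
      choose ξ hξ hξφ using fun j => RCLike.exists_norm_eq_mul_self (φ i (f (g j)))
      have h₁ : φ i (∑ j ∈ s, ξ j • f (g j)) = ((∑ j ∈ s, ‖φ i (f (g j))‖ : ℝ) : 𝕜) := by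
        simp [hξφ]
      have h₂ : ‖φ i (∑ j ∈ s, ξ j • f (g j))‖ ≤ 1 * ‖∑ j ∈ s, ξ j • f (g j)‖ :=
        (φ i).le_of_opNorm_le (hφ i) _
      rw [h₁, RCLike.norm_ofReal,
        abs_of_nonneg (Finset.sum_nonneg fun _ _ => norm_nonneg _)] at h₂
      have h₃ := hbound s ξ 1 zero_le_one fun j _ => (hξ j).le
      simp only [Function.comp_apply] at h₃
      linarith
  exact hF (containsCopyOfC0_of_almost_biorthogonal (hwuc.comp_injective hh)
    (φ := φ ∘ h) (fun j => hφ _) hδ (fun j => by simpa [hφf] using hfg (h j)) hoff)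

lemma sum_update_smul [DecidableEq ℕ] {s : Finset ℕ} {m : ℕ} (hm : m ∉ s) (σ : ℕ → 𝕜) (c : 𝕜)
    (v : ℕ → F) : ∑ i ∈ s, Function.update σ m c i • v i = ∑ i ∈ s, σ i • v i :=
  Finset.sum_congr rfl fun i hi => by rw [Function.update_of_ne (ne_of_mem_of_not_mem hi hm)]

/-- A diagonal sum `∑ uᵢ(zᵢ)` is controlled by the values of signed sums of the `uᵢ` at sums of the
`zᵢ` with the same signs. -/
lemma norm_add_sum_apply_le_of_signs (u : ℕ → F →L[𝕜] G) (z : ℕ → F) {C : ℝ} (s : Finset ℕ)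
    (A : F →L[𝕜] G) (b : F)
    (h : ∀ σ : ℕ → 𝕜, (∀ i, ‖σ i‖ ≤ 1) →
      ‖(A + ∑ i ∈ s, σ i • u i) (b + ∑ i ∈ s, σ i • z i)‖ ≤ C) :
    ‖A b + ∑ i ∈ s, u i (z i)‖ ≤ C := by
  classical
  induction s using Finset.induction_on generalizing A b with
  | empty => simpa using h 0 (by simp)
  | insert m s hm ih =>
    have key : ∀ c : 𝕜, ‖c‖ ≤ 1 →
        ‖(A + c • u m) (b + c • z m) + ∑ i ∈ s, u i (z i)‖ ≤ C := fun c hc => by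
      refine ih _ _ fun σ hσ => ?_
      have h' := h (Function.update σ m c) fun i => by
        rcases eq_or_ne i m with rfl | hi
        · simpa using hc
        · simpa [hi] using hσ i
      rw [Finset.sum_insert hm, Finset.sum_insert hm, sum_update_smul hm σ c u,
        sum_update_smul hm σ c z,
        Function.update_self, ← add_assoc, ← add_assoc] at h'
      exact h'
    have hplus := key 1 (by simp)
    have hminus := key (-1) (by simp)
    have havg : (2 : 𝕜) • (A b + ∑ i ∈ insert m s, u i (z i))
        = ((A + (1 : 𝕜) • u m) (b + (1 : 𝕜) • z m) + ∑ i ∈ s, u i (z i))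
          + ((A + (-1 : 𝕜) • u m) (b + (-1 : 𝕜) • z m) + ∑ i ∈ s, u i (z i)) := by
      rw [Finset.sum_insert hm]
      simp only [one_smul, neg_smul, add_apply, neg_apply,
        map_add, map_neg, two_smul]
      abel
    have h₂ := norm_add_le_of_le hplus hminus
    rw [← havg, norm_smul, RCLike.norm_ofNat] at h₂
    linarith

/-- A coordinate system identifying a normed space `E` with `c₀`. -/
structure C0Basis (𝕜 E : Type*) [RCLike 𝕜] [NormedAddCommGroup E] [NormedSpace 𝕜 E] where
  /-- The unit vectors. -/
  single : ℕ → E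
  /-- The coordinate functionals. -/
  coord : ℕ → E →L[𝕜] 𝕜
  coord_single : ∀ i j, coord j (single i) = if j = i then 1 else 0
  norm_le_iff : ∀ {x : E} {r : ℝ}, 0 ≤ r → (‖x‖ ≤ r ↔ ∀ i, ‖coord i x‖ ≤ r)
  hasSum_single : ∀ x, HasSum (fun i => coord i x • single i) x

namespace C0Basis

variable {E : Type*} [NormedAddCommGroup E] [NormedSpace 𝕜 E]

variable (𝕜) in
/-- The standard coordinates on `c₀`. -/
def standard : C0Basis 𝕜 (C0 𝕜) where
  single := C0.single 𝕜
  coord := C0.coord 𝕜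
  coord_single := C0.single_apply
  norm_le_iff := C0.norm_le
  hasSum_single := C0.hasSum_single

lemma norm_coord_le (b : C0Basis 𝕜 E) (x : E) (i : ℕ) : ‖b.coord i x‖ ≤ ‖x‖ :=
  (b.norm_le_iff (norm_nonneg x)).1 le_rfl i

lemma coord_sum_smul_single (b : C0Basis 𝕜 E) (s : Finset ℕ) (ξ : ℕ → 𝕜) (j : ℕ) :
    b.coord j (∑ i ∈ s, ξ i • b.single i) = if j ∈ s then ξ j else 0 := by
  simp [b.coord_single]

/-- A sum of disjointly supported elements of the unit ball of `c₀` stays in the unit ball. -/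
lemma norm_sum_smul_blocks_le (b : C0Basis 𝕜 E) {A : ℕ → Finset ℕ}
    (hA : Pairwise fun m k => Disjoint (A m) (A k)) {x : ℕ → E} (hx : ∀ m, ‖x m‖ ≤ 1)
    {σ : ℕ → 𝕜} (hσ : ∀ m, ‖σ m‖ ≤ 1) (s : Finset ℕ) :
    ‖∑ m ∈ s, σ m • ∑ i ∈ A m, b.coord i (x m) • b.single i‖ ≤ 1 := by
  rw [b.norm_le_iff zero_le_one]
  intro j
  simp only [map_sum (b.coord j) _ s, map_smul (b.coord j) (σ _), b.coord_sum_smul_single]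
  by_cases hj : ∃ m ∈ s, j ∈ A m
  · obtain ⟨m, hm, hj⟩ := hj
    rw [Finset.sum_eq_single_of_mem m hm fun k _ hk => by
      rw [if_neg (Finset.disjoint_left.1 (hA hk.symm) hj), smul_zero], if_pos hj, norm_smul]
    exact mul_le_one₀ (hσ m) (norm_nonneg _) ((b.norm_coord_le _ _).trans (hx m))
  · push Not at hj
    rw [Finset.sum_eq_zero fun m hm => by rw [if_neg (hj m hm), smul_zero]]
    simp

end C0Basis

variable {E : Type*} [NormedAddCommGroup E] [NormedSpace 𝕜 E]

lemma WUCTermsNull.clm (b : C0Basis 𝕜 E) (hF : WUCTermsNull 𝕜 F) : WUCTermsNull 𝕜 (E →L[𝕜] F) := by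
  classical
  intro U hU
  by_contra hlim
  obtain ⟨δ, hδ, g, hg, hgδ⟩ := exists_injective_of_not_tendsto hlim
  have hV := hU.comp_injective hg
  set V := U ∘ g
  have hsymm : Std.Symm fun p q : ℕ × Finset ℕ × E => p.1 ≠ q.1 ∧ Disjoint p.2.1 q.2.1 :=
    ⟨fun _ _ h => ⟨h.1.symm, h.2.symm⟩⟩
  obtain ⟨p, hp, hdisj⟩ := exists_seq_of_forall_finset_exists'
    (fun p : ℕ × Finset ℕ × E => ‖p.2.2‖ ≤ 1 ∧
      δ / 4 ≤ ‖V p.1 (∑ i ∈ p.2.1, b.coord i p.2.2 • b.single i)‖)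
    (fun p q => p.1 ≠ q.1 ∧ Disjoint p.2.1 q.2.1) fun S _ => by
      have hnull : Tendsto (fun k => ∑ i ∈ S.biUnion (fun p => p.2.1), ‖V k (b.single i)‖)
          cofinite (𝓝 0) := by
        rw [← Finset.sum_const_zero (s := S.biUnion fun p => p.2.1)]
        refine tendsto_finsetSum _ fun i _ => ?_
        have := (hF _ (hV.clm_comp (ContinuousLinearMap.apply 𝕜 F (b.single i)))).norm
        simpa using this
      obtain ⟨k, hk, hkS⟩ := ((hnull.eventually_lt_const (show 0 < δ / 4 by positivity)).and
        (S.image Prod.fst).eventually_cofinite_notMem).exists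
      obtain ⟨x, hx, hVx⟩ := (V k).exists_lt_apply_of_lt_opNorm
        (show δ / 2 < ‖V k‖ from (half_lt_self hδ).trans_le (hgδ k))
      have hlimx : Tendsto (fun s : Finset ℕ => ‖V k (∑ i ∈ s, b.coord i x • b.single i)‖) atTop
          (𝓝 ‖V k x‖) := (((V k).continuous.tendsto x).comp (b.hasSum_single x)).norm
      obtain ⟨s, hs, hBs⟩ := ((hlimx.eventually_const_lt hVx).and
        (eventually_ge_atTop (S.biUnion fun p => p.2.1))).exists
      refine ⟨(k, s \ S.biUnion (fun p => p.2.1), x), ⟨hx.le, ?_⟩, fun q hq => ⟨?_, ?_⟩⟩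
      · have hB : ‖V k (∑ i ∈ S.biUnion (fun p => p.2.1), b.coord i x • b.single i)‖
            ≤ ∑ i ∈ S.biUnion (fun p => p.2.1), ‖V k (b.single i)‖ := by
          rw [map_sum]
          refine norm_sum_le_of_le _ fun i _ => ?_
          rw [map_smul, norm_smul]
          exact mul_le_of_le_one_left (norm_nonneg _) ((b.norm_coord_le x i).trans hx.le)
        rw [← Finset.sum_sdiff hBs, map_add] at hs
        have := norm_add_le (V k (∑ i ∈ s \ S.biUnion (fun p => p.2.1), b.coord i x • b.single i))
          (V k (∑ i ∈ S.biUnion (fun p => p.2.1), b.coord i x • b.single i))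
        linarith
      · rintro rfl
        exact hkS (Finset.mem_image_of_mem _ hq)
      · exact (Finset.sdiff_disjoint.mono_right
          (Finset.subset_biUnion_of_mem (fun p : ℕ × Finset ℕ × E => p.2.1) hq)).symm
  have hinj : Function.Injective fun m => (p m).1 := fun m k h => by
    by_contra hne
    exact (hdisj hne).1 h
  obtain ⟨C, hC, hbound⟩ := hV.comp_injective hinj
  have hwuc : IsWUC 𝕜 fun m => V (p m).1 (∑ i ∈ (p m).2.1, b.coord i (p m).2.2 • b.single i) := by
    refine ⟨C, hC, fun s ξ η hη hξ => ?_⟩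
    have h := norm_add_sum_apply_le_of_signs (fun m => ξ m • V (p m).1)
      (fun m => ∑ i ∈ (p m).2.1, b.coord i (p m).2.2 • b.single i) (C := C * η) s 0 0 fun σ hσ => by
        rw [zero_add, zero_add]
        refine (ContinuousLinearMap.le_opNorm _ _).trans ?_
        refine (mul_le_of_le_one_right (norm_nonneg _) (b.norm_sum_smul_blocks_le
          (fun m k hmk => (hdisj hmk).2) (fun m => (hp m).1) hσ s)).trans ?_
        simp only [smul_smul]
        refine hbound s (fun m => σ m * ξ m) η hη fun m hm => ?_
        rw [norm_mul]
        exact (mul_le_of_le_one_left (norm_nonneg _) (hσ m)).trans (hξ m hm)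
    rw [map_zero, zero_add] at h
    exact h
  have hnull := (hF _ hwuc).norm
  rw [norm_zero] at hnull
  obtain ⟨m, hm⟩ := (hnull.eventually_lt_const (show 0 < δ / 4 by positivity)).exists
  exact (hp m).2.not_gt hm

lemma WUCTermsNull.continuousMultilinearMap (b : C0Basis 𝕜 E) (hF : WUCTermsNull 𝕜 F) (n : ℕ) :
    WUCTermsNull 𝕜 (ContinuousMultilinearMap 𝕜 (fun _ : Fin n => E) F) := by
  induction n with
  | zero => exact hF.congr (continuousMultilinearCurryFin0 𝕜 (E) F).symm
  | succ n ih =>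
    exact (ih.clm b).congr (continuousMultilinearCurryLeftEquiv 𝕜 (fun _ : Fin (n + 1) => E) F).symm

/-- If weakly unconditionally Cauchy series in `F` have null terms, an operator `u : c₀ → F` is the
norm-convergent sum of its one-dimensional pieces `x ↦ xᵢ • u(eᵢ)`. -/
lemma WUCTermsNull.hasSum_smulRight [CompleteSpace F] (b : C0Basis 𝕜 E) (hF : WUCTermsNull 𝕜 F)
    (u : E →L[𝕜] F) :
    HasSum (fun i => (b.coord i).smulRight (u (b.single i))) u := by
  have hwuc : IsWUC 𝕜 fun i => (b.coord i).smulRight (u (b.single i)) := by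
    refine ⟨‖u‖, norm_nonneg _, fun s ξ η hη hξ => ?_⟩
    refine ContinuousLinearMap.opNorm_le_bound _ (by positivity) fun x => ?_
    have hx : (∑ i ∈ s, ξ i • (b.coord i).smulRight (u (b.single i))) x
        = u (∑ i ∈ s, (ξ i * b.coord i x) • b.single i) := by
      simp [smul_smul]
    rw [hx, mul_assoc]
    refine (u.le_opNorm _).trans ?_
    gcongr
    rw [b.norm_le_iff (by positivity)]
    intro j
    rw [b.coord_sum_smul_single]
    split_ifs with hj
    · rw [norm_mul]
      gcongr
      · exact hξ j hj
      · exact b.norm_coord_le x j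
    · rw [norm_zero]
      positivity
  obtain ⟨v, hv⟩ := (hF.clm b).summable hwuc
  suffices h : v = u by rwa [h] at hv
  ext x
  have h₁ := hv.mapL (ContinuousLinearMap.apply 𝕜 F x)
  have h₂ := (b.hasSum_single x).mapL u
  refine h₁.unique ?_
  simpa using h₂

lemma isFiniteType_of_fintype {n : ℕ} {E : Fin n → Type*}
    [∀ i, NormedAddCommGroup (E i)] [∀ i, NormedSpace 𝕜 (E i)]
    {T : ContinuousMultilinearMap 𝕜 E F} {ι : Type*} [Fintype ι] (φ : ι → ∀ i, E i →L[𝕜] 𝕜)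
    (f : ι → F) (h : ∀ x, T x = ∑ p, (∏ i, φ p i (x i)) • f p) : IsFiniteType T :=
  ⟨Fintype.card ι, fun p => φ ((Fintype.equivFin ι).symm p),
    fun p => f ((Fintype.equivFin ι).symm p), fun x => by
      rw [h, (Fintype.equivFin ι).symm.sum_comp fun p => (∏ i, φ p i (x i)) • f p]⟩

/-- The additive monoid of finite type continuous multilinear maps on `Eⁿ`. -/
def finiteType (𝕜 E F : Type*) [RCLike 𝕜] [NormedAddCommGroup E] [NormedSpace 𝕜 E]
    [NormedAddCommGroup F] [NormedSpace 𝕜 F] (n : ℕ) :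
    AddSubmonoid (ContinuousMultilinearMap 𝕜 (fun _ : Fin n => E) F) where
  carrier := {T | IsFiniteType T}
  zero_mem' := ⟨0, Fin.elim0, Fin.elim0, by simp⟩
  add_mem' := by
    rintro S T ⟨r, φ, f, hS⟩ ⟨r', ψ, g, hT⟩
    exact isFiniteType_of_fintype (ι := Fin r ⊕ Fin r') (Sum.elim φ ψ) (Sum.elim f g)
      fun x => by simp [hS, hT]

lemma IsFiniteType.uncurryLeft_smulRight {n : ℕ} (φ : E →L[𝕜] 𝕜)
    {T : ContinuousMultilinearMap 𝕜 (fun _ : Fin n => E) F} (hT : IsFiniteType T) :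
    IsFiniteType ((continuousMultilinearCurryLeftEquiv 𝕜 (fun _ : Fin (n + 1) => E) F).symm
      (φ.smulRight T)) := by
  obtain ⟨r, ψ, f, h⟩ := hT
  refine ⟨r, fun p => Fin.cons φ (ψ p), f, fun x => ?_⟩
  simp [h, Fin.prod_univ_succ, Finset.smul_sum, smul_smul, Fin.tail]

/-- If weakly unconditionally Cauchy series in `F` have null terms, every continuous multilinear map
on `c₀` is a norm limit of finite type maps. -/
lemma WUCTermsNull.mem_closure_finiteType [CompleteSpace F] (b : C0Basis 𝕜 E) (hF : WUCTermsNull 𝕜 F) (n : ℕ)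
    (T : ContinuousMultilinearMap 𝕜 (fun _ : Fin n => E) F) :
    T ∈ (finiteType 𝕜 E F n).topologicalClosure := by
  induction n with
  | zero =>
    refine subset_closure ⟨1, fun _ i => i.elim0, fun _ => T 0, fun x => ?_⟩
    simp [Subsingleton.elim x 0]
  | succ n ih =>
    set e := continuousMultilinearCurryLeftEquiv 𝕜 (fun _ : Fin (n + 1) => E) F
    have hsum := ((hF.continuousMultilinearMap b n).hasSum_smulRight b (e T)).mapL
      e.symm.toContinuousLinearEquiv.toContinuousLinearMap
    have hT : e.symm (e T) = T := e.symm_apply_apply T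
    rw [← hT]
    refine (finiteType 𝕜 E F (n + 1)).isClosed_topologicalClosure.mem_of_tendsto hsum
      (Eventually.of_forall fun s => AddSubmonoid.sum_mem _ fun i _ => ?_)
    have hcont : Continuous fun S => e.symm ((b.coord i).smulRight S) :=
      e.symm.continuous.comp
        (ContinuousLinearMap.smulRightL 𝕜 (E) _ (b.coord i)).continuous
    have hmem := map_mem_closure (t := {T | IsFiniteType T}) hcont (ih (e T (b.single i)))
      fun S hS => IsFiniteType.uncurryLeft_smulRight (b.coord i) hS
    exact hmem

lemma WUCTermsNull.exists_isFiniteType_norm_sub_le [CompleteSpace F] (b : C0Basis 𝕜 E)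
    (hF : WUCTermsNull 𝕜 F) {n : ℕ} (T : ContinuousMultilinearMap 𝕜 (fun _ : Fin n => E) F)
    {ε : ℝ} (hε : 0 < ε) :
    ∃ S : ContinuousMultilinearMap 𝕜 (fun _ : Fin n => E) F, IsFiniteType S ∧
      ∀ x : E, ‖x‖ ≤ 1 → ‖T (fun _ => x) - S (fun _ => x)‖ ≤ ε := by
  obtain ⟨S, hS, hTS⟩ := Metric.mem_closure_iff.1 (hF.mem_closure_finiteType b n T) ε hε
  refine ⟨S, hS, fun x hx => ?_⟩
  rw [← sub_apply]
  refine ((T - S).le_opNorm _).trans ?_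
  rw [dist_eq_norm] at hTS
  have hprod : ∏ _i : Fin n, ‖x‖ ≤ 1 := Finset.prod_le_one (fun _ _ => norm_nonneg x) fun _ _ => hx
  exact (mul_le_of_le_one_right (norm_nonneg _) hprod).trans hTS.le

end Helpers

theorem stmt6 (𝕜 : Type*) [RCLike 𝕜] (n : ℕ) (hn : 1 ≤ n)
    (F : Type*) [NormedAddCommGroup F] [NormedSpace 𝕜 F] [CompleteSpace F]
    (hF : ¬ ContainsCopyOfC0 𝕜 F)
    (T : ContinuousMultilinearMap 𝕜 (fun _ : Fin n => ZeroAtInftyContinuousMap ℕ 𝕜) F) :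
    ∀ ε > (0 : ℝ),
      ∃ S : ContinuousMultilinearMap 𝕜 (fun _ : Fin n => ZeroAtInftyContinuousMap ℕ 𝕜) F,
        IsFiniteType S ∧
        ∀ x : ZeroAtInftyContinuousMap ℕ 𝕜, ‖x‖ ≤ 1 →
          ‖T (fun _ => x) - S (fun _ => x)‖ ≤ ε := by
  intro ε hε
  exact (wucTermsNull_of_not_containsCopyOfC0 hF).exists_isFiniteType_norm_sub_le
    (C0Basis.standard 𝕜) T hε


end GV
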